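/- Suppose the rule set D includes the Antecedent, Reflexivity of equality, ∃-introduction in antecedent, and ∃-introduction in succedent rules together with at least one of the Contradiction+ or Contradiction− rules. If Φ ∪ {∃x_m φ} is D-consistent, then Φ ∪ {φ[x_n/x_m]} is D-consistent for every variable x_n not occurring free in Φ ∪ {∃x_m φ}. -/

import Mathlib

/-! Common development: first-order syntax with NOR and a single quantifier,
sequent rules, derivations, consistency, semantics. Variables are indexed by ℕ
(the countably infinite variable set X). -/

/-- The alphabet: symbols of `S`, variables, and the logical symbols `↓ ≡ ∃`. -/
inductive Alph (S : Type) : Type where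
  | sym : S → Alph S
  | var : ℕ → Alph S
  | nor : Alph S
  | eqs : Alph S
  | exs : Alph S

/-- Terms over a symbol set `S` with signed arity `ar`. -/
inductive Tm (S : Type) (ar : S → ℤ) : Type where
  | var : ℕ → Tm S ar
  | const : (s : S) → ar s = 0 → Tm S ar
  | func : (s : S) → 0 < ar s → (Fin (ar s).toNat → Tm S ar) → Tm S ar

/-- Formulas over `S`: equality, relational atoms, NOR, existential quantification. -/
inductive Fm (S : Type) (ar : S → ℤ) : Type where
  | eq : Tm S ar → Tm S ar → Fm S ar
  | rel : (s : S) → ar s < 0 → (Fin (-ar s).toNat → Tm S ar) → Fm S ar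
  | nor : Fm S ar → Fm S ar → Fm S ar
  | ex : ℕ → Fm S ar → Fm S ar

variable {S : Type} {ar : S → ℤ}

/-- `¬φ` abbreviates `↓φφ`. -/
def Fm.neg (φ : Fm S ar) : Fm S ar := Fm.nor φ φ

/-- Substitution of a term for a variable in a term. -/
def Tm.substT : Tm S ar → ℕ → Tm S ar → Tm S ar
  | Tm.var n, x, u => if n = x then u else Tm.var n
  | Tm.const s h, _, _ => Tm.const s h
  | Tm.func s h ts, x, u => Tm.func s h (fun i => (ts i).substT x u)

/-- Substitution `φ[u/x]` of a term for the free occurrences of a variable in a formula. -/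
def Fm.substF : Fm S ar → ℕ → Tm S ar → Fm S ar
  | Fm.eq t₁ t₂, x, u => Fm.eq (t₁.substT x u) (t₂.substT x u)
  | Fm.rel s h ts, x, u => Fm.rel s h (fun i => (ts i).substT x u)
  | Fm.nor φ ψ, x, u => Fm.nor (φ.substF x u) (ψ.substF x u)
  | Fm.ex y φ, x, u => if y = x then Fm.ex y φ else Fm.ex y (φ.substF x u)

/-- Variables occurring in a term. -/
def Tm.varsT : Tm S ar → Set ℕ
  | Tm.var n => {n}
  | Tm.const _ _ => ∅
  | Tm.func _ _ ts => ⋃ i, (ts i).varsT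

/-- Free variables of a formula. -/
def Fm.freeF : Fm S ar → Set ℕ
  | Fm.eq t₁ t₂ => t₁.varsT ∪ t₂.varsT
  | Fm.rel _ _ ts => ⋃ i, (ts i).varsT
  | Fm.nor φ ψ => φ.freeF ∪ ψ.freeF
  | Fm.ex y φ => φ.freeF \ {y}

/-- Free variables of a set of formulas. -/
def FreeSet (Φ : Set (Fm S ar)) : Set ℕ := ⋃ φ ∈ Φ, φ.freeF

/-- Atomic formulas: equalities and relational atoms. -/
def Fm.Atomic : Fm S ar → Prop
  | Fm.eq _ _ => True
  | Fm.rel _ _ _ => True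
  | _ => False

/-- The ten basic sequent rules. -/
inductive Rule : Type where
  | ass | ant | refl | subst | exS | exA | norI | norS | ctrP | ctrN
  deriving DecidableEq

noncomputable instance : DecidableEq (Fm S ar) := Classical.decEq _

/-- Derivability of a sequent `Γ φ` using only the rules in `D`. -/
inductive Der (D : Set Rule) : Finset (Fm S ar) → Fm S ar → Prop where
  | ass : Rule.ass ∈ D → ∀ {Γ : Finset (Fm S ar)} {φ : Fm S ar}, φ ∈ Γ → Der D Γ φ
  | ant : Rule.ant ∈ D → ∀ {Γ Γ' : Finset (Fm S ar)} {φ : Fm S ar},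
      Γ ⊆ Γ' → Der D Γ φ → Der D Γ' φ
  | refl : Rule.refl ∈ D → ∀ t : Tm S ar, Der D ∅ (Fm.eq t t)
  | subst : Rule.subst ∈ D → ∀ {Γ : Finset (Fm S ar)} (φ : Fm S ar) (x : ℕ) (t t' : Tm S ar),
      Der D Γ (φ.substF x t) → Der D (insert (Fm.eq t t') Γ) (φ.substF x t')
  | exS : Rule.exS ∈ D → ∀ {Γ : Finset (Fm S ar)} (φ : Fm S ar) (x : ℕ) (t : Tm S ar),
      Der D Γ (φ.substF x t) → Der D Γ (Fm.ex x φ)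
  | exA : Rule.exA ∈ D → ∀ {Γ : Finset (Fm S ar)} (φ ψ : Fm S ar) (x x' : ℕ),
      x' ∉ FreeSet ((↑Γ : Set (Fm S ar)) ∪ {Fm.ex x φ, ψ}) →
      Der D (insert (φ.substF x (Tm.var x')) Γ) ψ → Der D (insert (Fm.ex x φ) Γ) ψ
  | norI : Rule.norI ∈ D → ∀ {Γ : Finset (Fm S ar)} {φ₁ φ₂ : Fm S ar},
      Der D Γ (Fm.nor φ₁ φ₁) → Der D Γ (Fm.nor φ₂ φ₂) → Der D Γ (Fm.nor φ₁ φ₂)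
  | norS : Rule.norS ∈ D → ∀ {Γ : Finset (Fm S ar)} {φ₁ φ₂ : Fm S ar},
      Der D Γ (Fm.nor φ₁ φ₂) → Der D Γ (Fm.nor φ₂ φ₁)
  | ctrP : Rule.ctrP ∈ D → ∀ {Γ : Finset (Fm S ar)} {φ ψ : Fm S ar},
      Der D (insert φ Γ) ψ → Der D (insert φ Γ) ψ.neg → Der D Γ φ.neg
  | ctrN : Rule.ctrN ∈ D → ∀ {Γ : Finset (Fm S ar)} {φ ψ : Fm S ar},
      Der D (insert φ.neg Γ) ψ → Der D (insert φ.neg Γ) ψ.neg → Der D Γ φ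

/-- `Φ ⊢_D φ` : some sequent `Γ φ` with `Γ` a finite subset of `Φ` is derivable using rules of `D`. -/
def Derives (D : Set Rule) (Φ : Set (Fm S ar)) (φ : Fm S ar) : Prop :=
  ∃ Γ : Finset (Fm S ar), (↑Γ : Set (Fm S ar)) ⊆ Φ ∧ Der D Γ φ

/-- `Φ` is `D`-consistent. -/
def Consistent (D : Set Rule) (Φ : Set (Fm S ar)) : Prop :=
  ¬ ∃ φ : Fm S ar, Derives D Φ φ ∧ Derives D Φ φ.neg

/-- `Φ` is a covering: it contains `φ` or `¬φ` for every formula `φ`. -/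
def Covering (Φ : Set (Fm S ar)) : Prop := ∀ φ : Fm S ar, φ ∈ Φ ∨ φ.neg ∈ Φ

/-- `Φ` is a minimal covering: exactly one of `φ`, `¬φ` belongs to `Φ`. -/
def MinimalCovering (Φ : Set (Fm S ar)) : Prop :=
  ∀ φ : Fm S ar, (φ ∈ Φ ∧ φ.neg ∉ Φ) ∨ (φ ∉ Φ ∧ φ.neg ∈ Φ)

/-- `Φ` is `D`-expanded: everything derivable from `Φ` is already in `Φ`. -/
def Expanded (D : Set Rule) (Φ : Set (Fm S ar)) : Prop :=
  ∀ φ : Fm S ar, Derives D Φ φ → φ ∈ Φ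

/-- `Φ` is `D`-maximal: a `D`-consistent covering. -/
def DMaximal (D : Set Rule) (Φ : Set (Fm S ar)) : Prop := Consistent D Φ ∧ Covering Φ

/-- `Φ` is witness-furnished. -/
def WitnessFurnished (Φ : Set (Fm S ar)) : Prop :=
  ∀ (x : ℕ) (φ : Fm S ar), Fm.ex x φ ∈ Φ → ∃ t : Tm S ar, φ.substF x t ∈ Φ

/-- An interpretation of `S`: a universe, interpretations of the symbols of the
appropriate arities (function symbols of arity `n > 0` as `n`-ary operations,
constants as elements via nullary operations, relation symbols of arity `-n`
as `n`-ary relations), and an assignment of the variables. -/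
structure Interp (S : Type) (ar : S → ℤ) : Type 1 where
  A : Type
  ifun : (s : S) → (Fin (ar s).toNat → A) → A
  irel : (s : S) → (Fin (-ar s).toNat → A) → Prop
  asg : ℕ → A

/-- Evaluation of terms. -/
def Interp.evalT (I : Interp S ar) : Tm S ar → I.A
  | Tm.var n => I.asg n
  | Tm.const s h => I.ifun s (fun i => absurd i.2 (by omega))
  | Tm.func s _ ts => I.ifun s (fun i => I.evalT (ts i))

/-- Mutation of the assignment at one variable. -/
def Interp.updAsg (I : Interp S ar) (x : ℕ) (a : I.A) : Interp S ar :=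
  { I with asg := Function.update I.asg x a }

/-- Tarskian satisfaction. -/
def Interp.Sat : (I : Interp S ar) → Fm S ar → Prop
  | I, Fm.eq t₁ t₂ => I.evalT t₁ = I.evalT t₂
  | I, Fm.rel s _ ts => I.irel s (fun i => I.evalT (ts i))
  | I, Fm.nor φ ψ => ¬ Interp.Sat I φ ∧ ¬ Interp.Sat I ψ
  | I, Fm.ex x φ => ∃ a : I.A, Interp.Sat (I.updAsg x a) φ

/-- `Φ` is satisfiable: some interpretation makes every formula of `Φ` true. -/
def Satisfiable (Φ : Set (Fm S ar)) : Prop := ∃ I : Interp S ar, ∀ φ ∈ Φ, I.Sat φ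

/-- Semantic entailment `Φ ⊨ φ`. -/
def Entails (Φ : Set (Fm S ar)) (φ : Fm S ar) : Prop :=
  ∀ I : Interp S ar, (∀ ψ ∈ Φ, I.Sat ψ) → I.Sat φ
variable {S : Type} {ar : S → ℤ}

/-- Polish-notation string of a term, as a word over the alphabet. -/
def Tm.toStr : Tm S ar → List (Alph S)
  | Tm.var n => [Alph.var n]
  | Tm.const s _ => [Alph.sym s]
  | Tm.func s _ ts => Alph.sym s :: (List.ofFn (fun i => (ts i).toStr)).flatten

/-- The relation `t₁ E_{(Φ,D)} t₂` iff `Φ ⊢_D ≡t₁t₂`. -/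
def Erel (D : Set Rule) (Φ : Set (Fm S ar)) (t₁ t₂ : Tm S ar) : Prop :=
  Derives D Φ (Fm.eq t₁ t₂)

/-- The Henkin interpretation `I_{(Φ,D)}`: the quotient of the term
interpretation `I_Φ` by the relation `E_{(Φ,D)}`. -/
noncomputable def henkin (D : Set Rule) (Φ : Set (Fm S ar)) : Interp S ar where
  A := Quot (Erel D Φ)
  ifun s f :=
    if h : 0 < ar s then Quot.mk _ (Tm.func s h (fun i => (f i).out))
    else if h0 : ar s = 0 then Quot.mk _ (Tm.const s h0)
    else Quot.mk _ (Tm.var 0)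
  irel s f := ∃ h : ar s < 0, Fm.rel s h (fun i => (f i).out) ∈ Φ
  asg n := Quot.mk _ (Tm.var n)

open Classical in
/-- The maximization sequence `Φ_j` of `Φ` along an enumeration `e` of the formulas. -/
noncomputable def maxSeq (D : Set Rule) (e : ℕ → Fm S ar) (Φ : Set (Fm S ar)) : ℕ → Set (Fm S ar)
  | 0 => Φ
  | n + 1 => maxSeq D e Φ n ∪
      {if Derives D (maxSeq D e Φ n) (e n).neg then (e n).neg else e n}

/-- `M⁺_D(Φ)`, the maximization of `Φ`. -/
noncomputable def Mplus (D : Set Rule) (e : ℕ → Fm S ar) (Φ : Set (Fm S ar)) : Set (Fm S ar) :=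
  ⋃ n, maxSeq D e Φ n

/-- A derivation of a sequent whose last (root) rule application is a rule of `D`
and all other rule applications use rules of `D₀`. -/
inductive DerTop (D₀ D : Set Rule) : Finset (Fm S ar) → Fm S ar → Prop where
  | ass : Rule.ass ∈ D → ∀ {Γ : Finset (Fm S ar)} {φ : Fm S ar}, φ ∈ Γ → DerTop D₀ D Γ φ
  | ant : Rule.ant ∈ D → ∀ {Γ Γ' : Finset (Fm S ar)} {φ : Fm S ar},
      Γ ⊆ Γ' → Der D₀ Γ φ → DerTop D₀ D Γ' φ
  | refl : Rule.refl ∈ D → ∀ t : Tm S ar, DerTop D₀ D ∅ (Fm.eq t t)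
  | subst : Rule.subst ∈ D → ∀ {Γ : Finset (Fm S ar)} (φ : Fm S ar) (x : ℕ) (t t' : Tm S ar),
      Der D₀ Γ (φ.substF x t) → DerTop D₀ D (insert (Fm.eq t t') Γ) (φ.substF x t')
  | exS : Rule.exS ∈ D → ∀ {Γ : Finset (Fm S ar)} (φ : Fm S ar) (x : ℕ) (t : Tm S ar),
      Der D₀ Γ (φ.substF x t) → DerTop D₀ D Γ (Fm.ex x φ)
  | exA : Rule.exA ∈ D → ∀ {Γ : Finset (Fm S ar)} (φ ψ : Fm S ar) (x x' : ℕ),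
      x' ∉ FreeSet ((↑Γ : Set (Fm S ar)) ∪ {Fm.ex x φ, ψ}) →
      Der D₀ (insert (φ.substF x (Tm.var x')) Γ) ψ → DerTop D₀ D (insert (Fm.ex x φ) Γ) ψ
  | norI : Rule.norI ∈ D → ∀ {Γ : Finset (Fm S ar)} {φ₁ φ₂ : Fm S ar},
      Der D₀ Γ (Fm.nor φ₁ φ₁) → Der D₀ Γ (Fm.nor φ₂ φ₂) → DerTop D₀ D Γ (Fm.nor φ₁ φ₂)
  | norS : Rule.norS ∈ D → ∀ {Γ : Finset (Fm S ar)} {φ₁ φ₂ : Fm S ar},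
      Der D₀ Γ (Fm.nor φ₁ φ₂) → DerTop D₀ D Γ (Fm.nor φ₂ φ₁)
  | ctrP : Rule.ctrP ∈ D → ∀ {Γ : Finset (Fm S ar)} {φ ψ : Fm S ar},
      Der D₀ (insert φ Γ) ψ → Der D₀ (insert φ Γ) ψ.neg → DerTop D₀ D Γ φ.neg
  | ctrN : Rule.ctrN ∈ D → ∀ {Γ : Finset (Fm S ar)} {φ ψ : Fm S ar},
      Der D₀ (insert φ.neg Γ) ψ → Der D₀ (insert φ.neg Γ) ψ.neg → DerTop D₀ D Γ φ
/-- With the Antecedent rule and one of the contradiction rules, a contradictory antecedent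
derives every negation. -/
theorem Der.neg_of_contradiction {S : Type} {ar : S → ℤ} {D : Set Rule} (hant : Rule.ant ∈ D)
    (hctr : Rule.ctrP ∈ D ∨ Rule.ctrN ∈ D) {Γ : Finset (Fm S ar)} {ψ : Fm S ar}
    (h : Der D Γ ψ) (hn : Der D Γ ψ.neg) (χ : Fm S ar) : Der D Γ χ.neg := by
  rcases hctr with hP | hN
  · exact .ctrP hP (.ant hant (Finset.subset_insert _ _) h)
      (.ant hant (Finset.subset_insert _ _) hn)
  · exact .ctrN hN (.ant hant (Finset.subset_insert _ _) h)
      (.ant hant (Finset.subset_insert _ _) hn)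

/-- Witness lemma: for `D` including Antecedent, Reflexivity, ∃-introduction in
antecedent and succedent, and one of the contradiction rules, consistency of
`Φ ∪ {∃x_m φ}` gives consistency of `Φ ∪ {φ[x_n/x_m]}` for every variable `x_n`
not free in `Φ ∪ {∃x_m φ}`. -/
theorem stmt14 {S : Type} [Countable S] {ar : S → ℤ} (D : Set Rule)
    (hant : Rule.ant ∈ D) (hrefl : Rule.refl ∈ D)
    (hexA : Rule.exA ∈ D) (hexS : Rule.exS ∈ D)
    (hctr : Rule.ctrP ∈ D ∨ Rule.ctrN ∈ D)
    (Φ : Set (Fm S ar)) (m : ℕ) (φ : Fm S ar)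
    (hcon : Consistent D (Φ ∪ {Fm.ex m φ})) :
    ∀ n : ℕ, n ∉ FreeSet (Φ ∪ {Fm.ex m φ}) →
      Consistent D (Φ ∪ {φ.substF m (Tm.var n)}) := by
  rintro n hn ⟨ψ, ⟨Γ₁, hΓ₁, h₁⟩, ⟨Γ₂, hΓ₂, h₂⟩⟩
  set θ := φ.substF m (Tm.var n) with hθ
  set Γ := (Γ₁ ∪ Γ₂).erase θ with hΓ
  have hΓΦ : (↑Γ : Set (Fm S ar)) ⊆ Φ := by
    intro χ hχ
    obtain ⟨hne, hmem⟩ := Finset.mem_erase.1 (Finset.mem_coe.1 hχ)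
    have hχΦ : χ ∈ Φ ∪ {θ} :=
      (Finset.mem_union.1 hmem).elim (fun h => hΓ₁ h) (fun h => hΓ₂ h)
    exact hχΦ.resolve_right hne
  have hsub : Γ₁ ∪ Γ₂ ⊆ insert θ Γ := by
    rw [hΓ]
    exact Finset.subset_insert_iff.2 subset_rfl
  have hneg : ∀ χ : Fm S ar, Der D (insert θ Γ) χ.neg :=
    Der.neg_of_contradiction hant hctr (.ant hant (Finset.subset_union_left.trans hsub) h₁)
      (.ant hant (Finset.subset_union_right.trans hsub) h₂)
  have hex : ∀ χ : Fm S ar, χ.freeF = ∅ → Derives D (Φ ∪ {Fm.ex m φ}) χ.neg := by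
    intro χ hχ
    refine ⟨insert (Fm.ex m φ) Γ, ?_, .exA hexA φ χ.neg m n ?_ (hneg χ)⟩
    · rw [Finset.coe_insert, Set.union_singleton]
      exact Set.insert_subset_insert hΓΦ
    · intro hmem
      simp only [FreeSet, Set.mem_iUnion, exists_prop] at hmem hn
      obtain ⟨α, hα | rfl | rfl, hnα⟩ := hmem
      · exact hn ⟨α, Or.inl (hΓΦ hα), hnα⟩
      · exact hn ⟨_, Or.inr rfl, hnα⟩
      · simp [Fm.neg, Fm.freeF, hχ] at hnα
  have hclosed : (Fm.ex 0 (Fm.eq (Tm.var 0) (Tm.var 0)) : Fm S ar).freeF = ∅ := by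
    simp [Fm.freeF, Tm.varsT]
  exact hcon ⟨_, hex _ hclosed, hex _ (by simp [Fm.neg, Fm.freeF, Tm.varsT])⟩
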